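/- Let G be a finite connected simple graph with edge set E that is 2-edge-connected, and let P_G = conv({1_{E∖T} : T the edge set of a spanning tree of G} ∪ {1_{E∖F} : F the edge set of a spanning two-forest of G}) ⊆ ℝ^E. Then the lattice points of P_G are exactly the vectors 1_{E∖T} (T a spanning tree) and 1_{E∖F} (F a spanning two-forest); in particular P_G has no lattice points other than these vertices. -/

import Mathlib

open scoped Pointwise
open Classical

noncomputable section

/-- `T` is the edge set of a spanning tree of `G`. -/
def IsSpanningTreeEdges {V : Type*} (G : SimpleGraph V) (T : Set (Sym2 V)) : Prop :=
  T ⊆ G.edgeSet ∧ (SimpleGraph.fromEdgeSet T).IsTree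

/-- `F` is the edge set of a spanning two-forest of `G`: a spanning subgraph that is
acyclic and has exactly two connected components. -/
def IsSpanningTwoForestEdges {V : Type*} (G : SimpleGraph V) (F : Set (Sym2 V)) : Prop :=
  F ⊆ G.edgeSet ∧ (SimpleGraph.fromEdgeSet F).IsAcyclic ∧
    Nat.card (SimpleGraph.fromEdgeSet F).ConnectedComponent = 2

/-- The indicator vector of `E ∖ S` in `ℝ^E`, where `E` is the edge set of `G`. -/
def coIndicator {V : Type*} (G : SimpleGraph V) (S : Set (Sym2 V)) : G.edgeSet → ℝ :=
  fun e => if (e : Sym2 V) ∈ S then 0 else 1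

/-- The standard basis vector indexed by `f`. -/
def stdVec {ι : Type*} (f : ι) : ι → ℝ := fun e => if e = f then 1 else 0

/-- `x` is a lattice point (all coordinates are integers). -/
def IsLatticePt {ι : Type*} (x : ι → ℝ) : Prop := ∀ i, ∃ n : ℤ, x i = (n : ℝ)

/-- The integer decomposition property for a set `P ⊆ ℝ^ι`. -/
def HasIDP {ι : Type*} (P : Set (ι → ℝ)) : Prop :=
  ∀ k : ℕ, 1 ≤ k →
    ((k : ℝ) • P) ∩ {x | IsLatticePt x} =
      ((((k - 1 : ℕ) : ℝ) • P) ∩ {x | IsLatticePt x}) + (P ∩ {x | IsLatticePt x})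

/-- A subset of the unit cube contains every lattice point of its convex hull, since
the lattice points of the cube are its extreme points. -/
theorem convexHull_inter_isLatticePt_subset {ι : Type*} {A : Set (ι → ℝ)}
    (hA : A ⊆ Set.univ.pi fun _ => Set.Icc 0 1) :
    convexHull ℝ A ∩ {x | IsLatticePt x} ⊆ A := by
  rintro x ⟨hx, hlat⟩
  have hsub : convexHull ℝ A ⊆ Set.univ.pi fun _ => Set.Icc 0 1 :=
    convexHull_min hA (convex_pi fun _ _ => convex_Icc 0 1)
  refine extremePoints_convexHull_subset
    (inter_extremePoints_subset_extremePoints_of_subset hsub ⟨hx, ?_⟩)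
  rw [extremePoints_pi]
  intro i _
  obtain ⟨n, hn⟩ := hlat i
  obtain ⟨h0, h1⟩ := hsub hx i trivial
  rw [hn] at h0 h1
  have hn0 : 0 ≤ n := by exact_mod_cast h0
  have hn1 : n ≤ 1 := by exact_mod_cast h1
  rw [Set.extremePoints_Icc zero_le_one, hn]
  interval_cases n <;> simp

theorem coIndicator_mem_unitCube {V : Type*} (G : SimpleGraph V) (S : Set (Sym2 V)) :
    coIndicator G S ∈ Set.univ.pi fun _ => Set.Icc (0 : ℝ) 1 := by
  intro e _
  unfold coIndicator
  split_ifs <;> simp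

theorem isLatticePt_coIndicator {V : Type*} (G : SimpleGraph V) (S : Set (Sym2 V)) :
    IsLatticePt (coIndicator G S) := by
  intro e
  unfold coIndicator
  split_ifs
  exacts [⟨0, by simp⟩, ⟨1, by simp⟩]

/-- For a 2-edge-connected graph `G`, the lattice points of the massless
Newton polytope `P_G = conv({1_{E∖T}} ∪ {1_{E∖F}})` are exactly the indicator vectors
`1_{E∖T}` (spanning trees `T`) and `1_{E∖F}` (spanning two-forests `F`). -/
theorem lattice_points_of_massless_polytope {V : Type*} [Fintype V] (G : SimpleGraph V)
    (hconn : G.Connected)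
    (h2ec : ∀ e ∈ G.edgeSet, (G.deleteEdges {e}).Connected) :
    (convexHull ℝ
        ({x : G.edgeSet → ℝ | ∃ T, IsSpanningTreeEdges G T ∧ x = coIndicator G T} ∪
          {x : G.edgeSet → ℝ | ∃ F, IsSpanningTwoForestEdges G F ∧ x = coIndicator G F})) ∩
        {x | IsLatticePt x} =
      {x : G.edgeSet → ℝ | ∃ T, IsSpanningTreeEdges G T ∧ x = coIndicator G T} ∪
        {x : G.edgeSet → ℝ | ∃ F, IsSpanningTwoForestEdges G F ∧ x = coIndicator G F} := by
  apply subset_antisymm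
  · apply convexHull_inter_isLatticePt_subset
    rintro _ (⟨S, -, rfl⟩ | ⟨S, -, rfl⟩) <;> exact coIndicator_mem_unitCube G S
  · refine Set.subset_inter (subset_convexHull ℝ _) ?_
    rintro _ (⟨S, -, rfl⟩ | ⟨S, -, rfl⟩) <;> exact isLatticePt_coIndicator G S
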